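/- Let d ≥ n ≥ 2, and let ω be the weight vector with ω_i = n−1 for 1 ≤ i ≤ d, ω_{d+1} = 1, and ω_i = 0 for i > d+1 (this is ω(X_n^{2^d−1} x_n^{2^d})). Then X_n^{2^d−1} x_n^{2^d} + Σ_{(i;I)∈N_{n−1}} φ_{(i;I∪n)}(X^{2^d−1}) x_n^{2^d} ∈ A_n^+P_n + P_n^−(ω). -/

import Mathlib

open MvPolynomial

noncomputable section

/-- `P n` is the polynomial algebra `F_2[x_1, …, x_n]`, with `x_{k+1}` corresponding to
the variable indexed by `k : Fin n`. -/
abbrev P (n : ℕ) : Type := MvPolynomial (Fin n) (ZMod 2)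

/-- The total Steenrod square, the ring homomorphism determined by `x_i ↦ x_i + x_i^2`. -/
def sqTot (n : ℕ) : P n →ₐ[ZMod 2] P n := bind₁ fun i => X i + X i ^ 2

/-- The Steenrod square `Sq^k`: on a homogeneous polynomial of degree `d` it is the
homogeneous component of degree `d + k` of the total square, extended additively. -/
def SqK (n k : ℕ) (f : P n) : P n :=
  ∑ d ∈ Finset.range (f.totalDegree + 1),
    homogeneousComponent (d + k) (sqTot n (homogeneousComponent d f))

/-- `A^+ P_n = Σ_{j ≥ 1} Sq^j(P_n)`, the submodule of hit polynomials. -/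
def hitS (n : ℕ) : Submodule (ZMod 2) (P n) :=
  Submodule.span (ZMod 2) {g | ∃ j, 1 ≤ j ∧ ∃ h, g = SqK n j h}

/-- `A_s^+ P_n = Σ_{1 ≤ j < 2^s} Sq^j(P_n)`. -/
def AplusS (n s : ℕ) : Submodule (ZMod 2) (P n) :=
  Submodule.span (ZMod 2) {g | ∃ j, 1 ≤ j ∧ j < 2 ^ s ∧ ∃ h, g = SqK n j h}

/-- Degree of a monomial given by its exponent vector. -/
def mdeg {n : ℕ} (a : Fin n →₀ ℕ) : ℕ := ∑ j, a j

/-- The weight vector of a monomial, zero-based: `wt a i = ω_{i+1}(x) = Σ_j α_i(a_j)`. -/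
def wt {n : ℕ} (a : Fin n →₀ ℕ) (i : ℕ) : ℕ := ∑ j, a j / 2 ^ i % 2

/-- Left-lexicographic strict order on weight vectors. -/
def lexLt (w w' : ℕ → ℕ) : Prop := ∃ i, (∀ j, j < i → w j = w' j) ∧ w i < w' i

def lexLe (w w' : ℕ → ℕ) : Prop := w = w' ∨ lexLt w w'

/-- `P_n^-(ω)`: span of monomials of degree `D = deg ω` with weight vector `< ω`. -/
def PnLt (n D : ℕ) (w : ℕ → ℕ) : Submodule (ZMod 2) (P n) :=
  Submodule.span (ZMod 2)
    {p | ∃ a : Fin n →₀ ℕ, mdeg a = D ∧ lexLt (wt a) w ∧ p = monomial a 1}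

/-- `P_n(ω)`: span of monomials of degree `D = deg ω` with weight vector `≤ ω`. -/
def PnLe (n D : ℕ) (w : ℕ → ℕ) : Submodule (ZMod 2) (P n) :=
  Submodule.span (ZMod 2)
    {p | ∃ a : Fin n →₀ ℕ, mdeg a = D ∧ lexLe (wt a) w ∧ p = monomial a 1}

/-- The order on monomials (of a common degree): first by weight vector, then by
exponent vector, both left-lexicographically. -/
def monLt {n : ℕ} (a b : Fin n →₀ ℕ) : Prop :=
  lexLt (wt a) (wt b) ∨
    (wt a = wt b ∧ ∃ j : Fin n, (∀ k, k < j → a k = b k) ∧ a j < b j)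

/-- A monomial is inadmissible if it is congruent, modulo hit elements, to a sum of
strictly smaller monomials of the same degree. -/
def Inadmissible {n : ℕ} (a : Fin n →₀ ℕ) : Prop :=
  ∃ S : Finset (Fin n →₀ ℕ), (∀ b ∈ S, mdeg b = mdeg a ∧ monLt b a) ∧
    ((monomial a 1 : P n) + ∑ b ∈ S, monomial b 1) ∈ hitS n

def Admissible {n : ℕ} (a : Fin n →₀ ℕ) : Prop := ¬ Inadmissible a

/-- Strict inadmissibility: with `s` the top of the weight vector, the monomial is
congruent to a sum of smaller monomials modulo `A_s^+ P_n`. -/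
def StrictlyInadmissible {n : ℕ} (a : Fin n →₀ ℕ) : Prop :=
  ∃ s : ℕ, 1 ≤ s ∧ wt a (s - 1) ≠ 0 ∧ (∀ i, s ≤ i → wt a i = 0) ∧
    ∃ S : Finset (Fin n →₀ ℕ), (∀ b ∈ S, mdeg b = mdeg a ∧ monLt b a) ∧
      ((monomial a 1 : P n) + ∑ b ∈ S, monomial b 1) ∈ AplusS n s

/-- Exponent vector from a tuple of exponents. -/
def ev {n : ℕ} (v : Fin n → ℕ) : Fin n →₀ ℕ := Finsupp.equivFunOnFinite.symm v

/-- `ν_k(x)`, the exponent of the (1-based) variable `x_k` in a monomial. -/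
def nuE {m : ℕ} (b : Fin m →₀ ℕ) (k : ℕ) : ℕ := if h : k - 1 < m then b ⟨k - 1, h⟩ else 0

/-- `u`-compatibility of a monomial of `P_{n-1}` with a pair `(i; I)` (only `I` matters);
by convention every monomial is `1`-compatible with `(i; ∅)`. -/
def uCompat {m : ℕ} (I : List ℕ) (u : ℕ) (b : Fin m →₀ ℕ) : Prop :=
  if I = [] then u = 1 else
    1 ≤ u ∧ u ≤ I.length ∧
    (∀ t, 1 ≤ t → t < u → nuE b (I.getD (t - 1) 0 - 1) = 2 ^ I.length - 1) ∧
    2 ^ I.length - 1 < nuE b (I.getD (u - 1) 0 - 1) ∧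
    (∀ t, 1 ≤ t → t ≤ u → Nat.testBit (nuE b (I.getD (u - 1) 0 - 1)) (I.length - t) = true) ∧
    (∀ t, u < t → t ≤ I.length → Nat.testBit (nuE b (I.getD (t - 1) 0 - 1)) (I.length - t) = true)

/-- The exponent vector of `x_{(I,u)} = x_{i_u}^{2^{r-1}+⋯+2^{r-u}} Π_{u<t≤r} x_{i_t}^{2^{r-t}}`. -/
def xIuExp (n : ℕ) (I : List ℕ) (u : ℕ) : Fin n → ℕ := fun k =>
  (if I.getD (u - 1) 0 = (k : ℕ) + 1 then 2 ^ I.length - 2 ^ (I.length - u) else 0) +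
  ∑ t ∈ Finset.Icc (u + 1) I.length,
    if I.getD (t - 1) 0 = (k : ℕ) + 1 then 2 ^ (I.length - t) else 0

/-- The variable substitution underlying `f_i : P_{n-1} → P_n` (`x_j ↦ x_j` for `j < i`,
`x_j ↦ x_{j+1}` for `j ≥ i`, in 1-based labels). -/
def fIdx (n i : ℕ) (j : Fin (n - 1)) : Fin n :=
  if (j : ℕ) + 1 < i then ⟨j, by have := j.isLt; omega⟩
  else ⟨(j : ℕ) + 1, by have := j.isLt; omega⟩

open Classical in
/-- `φ_{(i;I)}` evaluated on the monomial of `P_{n-1}` with exponent vector `b`: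
`(x_i^{2^r - 1} f_i(x)) / x_{(I,u)}` if `x` is `u`-compatible with `(i;I)` for some `u`,
and `0` otherwise.  Here `i` and the entries of `I` are 1-based variable labels. -/
def phiMon (n i : ℕ) (I : List ℕ) (b : Fin (n - 1) →₀ ℕ) : P n :=
  if h : ∃ u, uCompat I u b then
    monomial (ev fun k : Fin n =>
      (if (k : ℕ) + 1 = i then 2 ^ I.length - 1 else 0) +
        Finsupp.mapDomain (fIdx n i) b k - xIuExp n I (Classical.choose h) k) 1
  else 0

/-- Exponent vector of `X^e = (x_1 ⋯ x_m)^e` in `P_m`. -/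
def Xexp (m e : ℕ) : Fin m →₀ ℕ := ev fun _ => e

/-- `X_u^e = (Π_{j ≠ u} x_j)^e` in `P_n` (`u` 1-based). -/
def XjMon (n u e : ℕ) : P n := monomial (ev fun k : Fin n => if (k : ℕ) + 1 = u then 0 else e) 1

/-- `x_u^e` in `P_n` (`u` 1-based). -/
def xvMon (n u e : ℕ) : P n := monomial (ev fun k : Fin n => if (k : ℕ) + 1 = u then e else 0) 1

/-- The weight vector `((n-1)^{(d)}, 1)` (zero-based indexing). -/
def wSpike (n d : ℕ) : ℕ → ℕ := fun i => if i < d then n - 1 else if i = d then 1 else 0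

/-- Kameko's map `ψ : P_5 → P_5`, `x_1x_2x_3x_4x_5 · y^2 ↦ y` on monomials, `0` otherwise. -/
def psi : P 5 →ₗ[ZMod 2] P 5 :=
  (basisMonomials (Fin 5) (ZMod 2)).constr (ZMod 2) fun a =>
    if ∀ j, Odd (a j) then monomial (Finsupp.mapRange (· / 2) (Nat.zero_div 2) a) 1 else 0

/-- The Σ₅-invariant subspace of a subspace `V` of `QP_5 = P_5 / A^+P_5`: classes in `V`
having a representative `f` with `[σ · f] = [f]` for all permutations `σ` of the variables. -/
def invSub (V : Submodule (ZMod 2) (P 5 ⧸ hitS 5)) : Submodule (ZMod 2) (P 5 ⧸ hitS 5) where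
  carrier := {q | q ∈ V ∧ ∃ f : P 5, (hitS 5).mkQ f = q ∧
      ∀ σ : Equiv.Perm (Fin 5), (hitS 5).mkQ (rename (⇑σ) f) = q}
  add_mem' := by
    rintro a b ⟨haV, f, hf, hfa⟩ ⟨hbV, g, hg, hgb⟩
    refine ⟨V.add_mem haV hbV, f + g, ?_, fun σ => ?_⟩
    · simp [map_add, hf, hg]
    · simp [map_add, hfa σ, hgb σ]
  zero_mem' := ⟨V.zero_mem, 0, by simp, fun σ => by simp⟩
  smul_mem' := by
    rintro c a ⟨haV, f, hf, hfa⟩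
    refine ⟨V.smul_mem c haV, c • f, ?_, fun σ => ?_⟩
    · simp [map_smul, hf]
    · simp [map_smul, hfa σ]

/-- The maps `ρ_1, …, ρ_5` generating the action of `GL_5` on `P_5`:
`ρ_i` (for `1 ≤ i ≤ 4`) swaps `x_i, x_{i+1}`; `ρ_5` sends `x_1 ↦ x_1 + x_2`. -/
def rho5 (i : ℕ) : P 5 → P 5 := fun f =>
  if i = 1 then rename (⇑(Equiv.swap (0 : Fin 5) 1)) f
  else if i = 2 then rename (⇑(Equiv.swap (1 : Fin 5) 2)) f
  else if i = 3 then rename (⇑(Equiv.swap (2 : Fin 5) 3)) f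
  else if i = 4 then rename (⇑(Equiv.swap (3 : Fin 5) 4)) f
  else if i = 5 then MvPolynomial.aeval (R := ZMod 2)
    (fun j : Fin 5 => if j = 0 then X 0 + X 1 else X j) f
  else f

/-- The action of an invertible matrix on `P_5` by linear substitution of the variables. -/
def glAct (g : Matrix (Fin 5) (Fin 5) (ZMod 2)) (f : P 5) : P 5 :=
  MvPolynomial.aeval (R := ZMod 2) (fun i : Fin 5 => ∑ j : Fin 5, g i j • X j) f

/-- The weight vector `(3,3,4)` (zero-based indexing). -/
def w334 : ℕ → ℕ := fun i => if i = 0 then 3 else if i = 1 then 3 else if i = 2 then 4 else 0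

/-- The weight vector `(3,3,2,1)` (zero-based indexing). -/
def w3321 : ℕ → ℕ := fun i =>
  if i = 0 then 3 else if i = 1 then 3 else if i = 2 then 2 else if i = 3 then 1 else 0


/-! ### Auxiliary material -/

def WW (n d : ℕ) : Submodule (ZMod 2) (P n) :=
  AplusS n n ⊔ PnLt n ((n - 1) * (2 ^ d - 1) + 2 ^ d) (wSpike n d)

def lowOf {n : ℕ} (m : ℕ → Fin n) (j : ℕ) (k : Fin n) : ℕ :=
  ∑ b ∈ Finset.range j, if m b = k then 0 else 2 ^ b

def NN {n : ℕ} (m : ℕ → Fin n) (j : ℕ) (g : Fin n → ℕ) : P n :=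
  monomial (ev fun k => lowOf m j k + 2 ^ j * g k) 1

theorem ev_apply {n : ℕ} (v : Fin n → ℕ) (k : Fin n) : ev v k = v k := rfl

theorem lowOf_succ {n : ℕ} (m : ℕ → Fin n) (j : ℕ) (k : Fin n) :
    lowOf m (j + 1) k = lowOf m j k + if m j = k then 0 else 2 ^ j := by
  simp [lowOf, Finset.sum_range_succ]

theorem lowOf_congr {n : ℕ} (m m' : ℕ → Fin n) (j : ℕ) (h : ∀ b < j, m b = m' b) (k : Fin n) :
    lowOf m j k = lowOf m' j k := by
  unfold lowOf
  refine Finset.sum_congr rfl fun b hb => ?_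
  rw [h b (Finset.mem_range.1 hb)]

theorem lowOf_split {n : ℕ} (m : ℕ → Fin n) (j t : ℕ) (k : Fin n) :
    lowOf m (j + t) k = lowOf m j k + 2 ^ j * lowOf (fun b => m (j + b)) t k := by
  unfold lowOf
  rw [Finset.sum_range_add, Finset.mul_sum]
  congr 1
  refine Finset.sum_congr rfl fun b _ => ?_
  split_ifs <;> simp [pow_add]

theorem lowOf_const {n : ℕ} (a : Fin n) (t : ℕ) (k : Fin n) :
    lowOf (fun _ => a) t k = if a = k then 0 else 2 ^ t - 1 := by
  induction t with
  | zero => simp [lowOf]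
  | succ t ih =>
    rw [lowOf_succ, ih]
    have := Nat.one_le_two_pow (n := t)
    split_ifs
    · rfl
    · rw [pow_succ]; omega

theorem lowOf_bit {n : ℕ} (m : ℕ → Fin n) (j b z : ℕ) (hb : b < j) (k : Fin n) :
    (lowOf m j k + 2 ^ j * z) / 2 ^ b % 2 = if m b = k then 0 else 1 := by
  induction j generalizing m b with
  | zero => omega
  | succ j ih =>
    have h := lowOf_split m 1 j k
    rw [add_comm 1 j] at h
    have h1 : lowOf m 1 k = if m 0 = k then 0 else 1 := by simp [lowOf]
    have hp : 2 ^ (j + 1) * z = 2 * (2 ^ j * z) := by ring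
    cases b with
    | zero =>
      rw [h, h1, hp]
      split_ifs <;> simp only [pow_zero, Nat.div_one, pow_one] <;> omega
    | succ b =>
      have := ih (fun b => m (1 + b)) b (by omega)
      have h2 : (lowOf m (j + 1) k + 2 ^ (j + 1) * z) / 2
          = lowOf (fun b => m (1 + b)) j k + 2 ^ j * z := by
        rw [h, h1, hp]
        split_ifs <;> simp only [pow_one] <;> omega
      rw [pow_succ' 2 b, ← Nat.div_div_eq_div_mul, h2, this, add_comm 1 b]

theorem sum_lowOf {n : ℕ} (m : ℕ → Fin n) (j : ℕ) :
    ∑ k, lowOf m j k = (n - 1) * (2 ^ j - 1) := by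
  induction j with
  | zero => simp [lowOf]
  | succ j ih =>
    simp only [lowOf_succ, Finset.sum_add_distrib, ih]
    have : ∑ x : Fin n, (if m j = x then 0 else 2 ^ j) = (n - 1) * 2 ^ j := by
      rw [Finset.sum_ite]
      simp [Finset.filter_ne, Finset.card_erase_of_mem]
    rw [this, ← mul_add, pow_succ]
    congr 1
    have := Nat.one_le_two_pow (n := j)
    omega

theorem wt_le_of_zero {n : ℕ} (a : Fin n →₀ ℕ) (b : ℕ) (k : Fin n) (h : a k / 2 ^ b % 2 = 0) :
    wt a b ≤ n - 1 := by
  unfold wt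
  rw [← Finset.add_sum_erase _ _ (Finset.mem_univ k), h, zero_add]
  refine (Finset.sum_le_card_nsmul _ _ 1 fun i _ => by omega).trans ?_
  simp [Finset.card_erase_of_mem]

theorem wt_lt_of_zero {n : ℕ} (a : Fin n →₀ ℕ) (b : ℕ) (k k' : Fin n) (hk : k ≠ k')
    (h : a k / 2 ^ b % 2 = 0) (h' : a k' / 2 ^ b % 2 = 0) :
    wt a b < n - 1 := by
  unfold wt
  have hm : k' ∈ Finset.univ.erase k := by simp [hk.symm]
  have hc : (Finset.univ.erase k : Finset (Fin n)).card = n - 1 := by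
    simp [Finset.card_erase_of_mem]
  have h0 : 0 < (Finset.univ.erase k : Finset (Fin n)).card := Finset.card_pos.2 ⟨_, hm⟩
  rw [← Finset.add_sum_erase _ _ (Finset.mem_univ k), h, zero_add,
    ← Finset.add_sum_erase _ _ hm, h', zero_add]
  refine (Finset.sum_le_card_nsmul _ _ 1 fun i _ => by omega).trans_lt ?_
  rw [Finset.card_erase_of_mem hm, hc]
  simp
  omega

theorem lexLt_crit (n d : ℕ) (w : ℕ → ℕ) (b0 : ℕ) (hb0 : b0 < d) (h : ∀ b ≤ b0, w b ≤ n - 1)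
    (h0 : w b0 < n - 1) : lexLt w (wSpike n d) := by
  classical
  have hex : ∃ b, w b < n - 1 := ⟨b0, h0⟩
  have hle := Nat.find_min' hex h0
  refine ⟨Nat.find hex, fun j hj => ?_, ?_⟩
  · have := Nat.find_min hex hj
    have := h j (by omega)
    unfold wSpike
    rw [if_pos (by omega)]
    omega
  · have := Nat.find_spec hex
    unfold wSpike
    rw [if_pos (by omega)]
    exact this

theorem low_mem {n d : ℕ} (a : Fin n →₀ ℕ) (hdeg : ∑ k, a k = (n - 1) * (2 ^ d - 1) + 2 ^ d)
    (b0 : ℕ) (hb0 : b0 < d) (h : ∀ b ≤ b0, wt a b ≤ n - 1) (h0 : wt a b0 < n - 1) :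
    (monomial a 1 : P n) ∈ WW n d := by
  refine Submodule.mem_sup_right (Submodule.subset_span ⟨a, hdeg, ?_, rfl⟩)
  exact lexLt_crit n d _ b0 hb0 h h0

theorem mod_two_pow_sum (x d : ℕ) :
    x % 2 ^ d = ∑ b ∈ Finset.range d, 2 ^ b * (x / 2 ^ b % 2) := by
  induction d with
  | zero => simp [Nat.mod_one]
  | succ d ih => rw [Finset.sum_range_succ, ← ih, Nat.mod_pow_succ]

theorem low_mem2 {n d : ℕ} (a : Fin n →₀ ℕ) (hdeg : ∑ k, a k = (n - 1) * (2 ^ d - 1) + 2 ^ d)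
    (h : ∀ b < d, wt a b ≤ n - 1) (h0 : 2 ≤ ∑ k, a k / 2 ^ d) :
    (monomial a 1 : P n) ∈ WW n d := by
  by_contra hcon
  have hall : ∀ b < d, n - 1 ≤ wt a b := by
    intro b hb
    by_contra hlt
    exact hcon (low_mem a hdeg b hb (fun b' hb' => h b' (by omega)) (by omega))
  have h1 : ∑ k, a k = ∑ k, a k % 2 ^ d + 2 ^ d * ∑ k, a k / 2 ^ d := by
    rw [Finset.mul_sum, ← Finset.sum_add_distrib]
    exact Finset.sum_congr rfl fun k _ => (Nat.mod_add_div _ _).symm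
  have h2 : ∑ k, a k % 2 ^ d = ∑ b ∈ Finset.range d, 2 ^ b * wt a b := by
    simp only [mod_two_pow_sum, wt, Finset.mul_sum]
    exact Finset.sum_comm
  have h3 : ∑ b ∈ Finset.range d, 2 ^ b * (n - 1) ≤ ∑ b ∈ Finset.range d, 2 ^ b * wt a b :=
    Finset.sum_le_sum fun b hb => Nat.mul_le_mul_left _ (hall b (Finset.mem_range.1 hb))
  have h4 : ∑ b ∈ Finset.range d, 2 ^ b * (n - 1) = (n - 1) * (2 ^ d - 1) := by
    rw [← Finset.sum_mul, mul_comm, Nat.geomSum_eq (le_refl 2)]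
    simp
  have h5 : 2 ^ d * 2 ≤ 2 ^ d * ∑ k, a k / 2 ^ d := Nat.mul_le_mul_left _ h0
  have := Nat.one_le_two_pow (n := d)
  omega

theorem choose_pow_mul (b e c : ℕ) :
    (((e.choose (2 ^ b * c) : ℕ)) : ZMod 2) = (((e / 2 ^ b).choose c : ℕ) : ZMod 2) := by
  induction b generalizing e with
  | zero => simp
  | succ b ih =>
    have h := (ZMod.natCast_eq_natCast_iff _ _ 2).2
      (Choose.choose_modEq_choose_mod_mul_choose_div_nat (n := e) (k := 2 ^ (b + 1) * c) (p := 2))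
    have h1 : 2 ^ (b + 1) * c = 2 * (2 ^ b * c) := by ring
    rw [h, h1, Nat.mul_mod_right, Nat.mul_div_cancel_left _ (by norm_num), Nat.choose_zero_right,
      one_mul, ih, Nat.div_div_eq_div_mul, ← pow_succ']

theorem choose_odd (e c : ℕ) (hc : c % 2 = 1) (he : e % 2 = 0) :
    ((e.choose c : ℕ) : ZMod 2) = 0 := by
  have h := (ZMod.natCast_eq_natCast_iff _ _ 2).2
      (Choose.choose_modEq_choose_mod_mul_choose_div_nat (n := e) (k := c) (p := 2))
  rw [h, hc, he]
  simp

theorem choose_two_pow (j e : ℕ) :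
    ((e.choose (2 ^ j) : ℕ) : ZMod 2) = if e / 2 ^ j % 2 = 1 then 1 else 0 := by
  have h := choose_pow_mul j e 1
  rw [mul_one] at h
  rw [h, Nat.choose_one_right, ← ZMod.natCast_mod]
  rcases Nat.mod_two_eq_zero_or_one (e / 2 ^ j) with h | h <;> simp [h]

theorem monomial_ev_eq {n : ℕ} (e : Fin n → ℕ) (r : ZMod 2) :
    (monomial (ev e) r : P n) = C r * ∏ i, X i ^ e i := by
  rw [monomial_eq, Finsupp.prod_fintype _ _ (by simp)]
  rfl

theorem sqTot_monomial {n : ℕ} (e : Fin n → ℕ) :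
    sqTot n (monomial (ev e) 1) =
      ∑ c ∈ Fintype.piFinset (fun i => Finset.range (e i + 1)),
        monomial (ev (e + c)) (∏ i, ((e i).choose (c i) : ZMod 2)) := by
  rw [monomial_ev_eq, map_one, one_mul, map_prod]
  have h : ∀ i, sqTot n (X i ^ e i) = ∑ c ∈ Finset.range (e i + 1),
      (C ((e i).choose c : ZMod 2) * X i ^ (e i + c) : P n) := by
    intro i
    have h1 : sqTot n (X i) = X i * (X i + 1) := by
      simp [sqTot]; ring
    rw [map_pow, h1, mul_pow, add_pow, Finset.mul_sum]
    refine Finset.sum_congr rfl fun c _ => ?_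
    simp only [one_pow, mul_one, map_natCast, pow_add]
    ring
  simp only [h]
  rw [Finset.prod_univ_sum]
  refine Finset.sum_congr rfl fun c _ => ?_
  rw [monomial_ev_eq, Finset.prod_mul_distrib, map_prod]
  rfl

theorem degree_ev {n : ℕ} (e : Fin n → ℕ) : (ev e).degree = ∑ i, e i := by
  rw [Finsupp.degree_eq_sum]
  rfl

theorem homComp_monomial {n : ℕ} (e : Fin n → ℕ) (r : ZMod 2) (k : ℕ) :
    homogeneousComponent k (monomial (ev e) r : P n) =
      if ∑ i, e i = k then monomial (ev e) r else 0 := by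
  have hh : (monomial (ev e) r : P n).IsHomogeneous (∑ i, e i) :=
    isHomogeneous_monomial r (degree_ev e)
  rw [homogeneousComponent_of_mem hh]
  simp only [eq_comm]

theorem SqK_monomial {n : ℕ} (e : Fin n → ℕ) (k : ℕ) :
    SqK n k (monomial (ev e) 1) =
      ∑ c ∈ Finset.piAntidiag Finset.univ k,
        monomial (ev (e + c)) (∏ i, ((e i).choose (c i) : ZMod 2)) := by
  classical
  unfold SqK
  have htd : (monomial (ev e) 1 : P n).totalDegree = ∑ i, e i := by
    rw [totalDegree_monomial _ one_ne_zero]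
    exact degree_ev e
  rw [htd, Finset.sum_eq_single (∑ i, e i)]
  · rw [homComp_monomial, if_pos rfl, sqTot_monomial, map_sum]
    simp only [homComp_monomial, Pi.add_apply, Finset.sum_add_distrib, Nat.add_left_cancel_iff]
    rw [← Finset.sum_filter]
    refine Finset.sum_subset_zero_on_sdiff ?_ ?_ (fun _ _ => rfl)
    · intro c hc
      simp only [Finset.mem_filter] at hc
      simp [hc.2]
    · intro c hc
      simp only [Finset.mem_sdiff, Finset.mem_piAntidiag, Finset.mem_filter, Fintype.mem_piFinset,
        Finset.mem_range, not_and] at hc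
      have h2 : ¬ ∀ i, c i < e i + 1 := fun h => hc.2 h hc.1.1
      push Not at h2
      obtain ⟨i, hi⟩ := h2
      rw [Finset.prod_eq_zero (Finset.mem_univ i), map_zero]
      rw [Nat.choose_eq_zero_of_lt (by omega)]
      simp
  · intro b _ hb
    rw [homComp_monomial, if_neg hb.symm]
    simp
  · intro h
    simp at h

theorem key {n d : ℕ} (hnd : n ≤ d) (m : ℕ → Fin n) (j : ℕ) (hj : j < n) (g : Fin n → ℕ)
    (hdeg : ∑ k, g k + 1 = (n - 1) * (2 ^ (d - j) - 1) + 2 ^ (d - j)) :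
    ∑ a, (if g a % 2 = 1 then NN m j (g + Pi.single a 1) else 0) ∈ WW n d := by
  classical
  set e : Fin n → ℕ := fun k => lowOf m j k + 2 ^ j * g k with he
  have hD : ∑ k, e k + 2 ^ j = (n - 1) * (2 ^ d - 1) + 2 ^ d := by
    obtain ⟨t, rfl⟩ : ∃ t, d = j + t := ⟨d - j, by omega⟩
    rw [Nat.add_sub_cancel_left] at hdeg
    have h1 : ∑ k, e k = (n - 1) * (2 ^ j - 1) + 2 ^ j * ∑ k, g k := by
      rw [he, Finset.sum_add_distrib, sum_lowOf, Finset.mul_sum]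
    have h2 : ∑ k, e k + 2 ^ j = (n - 1) * (2 ^ j - 1) + 2 ^ j * (∑ k, g k + 1) := by
      rw [h1]; ring
    rw [h2, hdeg, pow_add]
    obtain ⟨A, hA⟩ : ∃ A, 2 ^ j = A + 1 := ⟨2 ^ j - 1, (Nat.sub_add_cancel Nat.one_le_two_pow).symm⟩
    obtain ⟨B, hB⟩ : ∃ B, 2 ^ t = B + 1 := ⟨2 ^ t - 1, (Nat.sub_add_cancel Nat.one_le_two_pow).symm⟩
    have h3 : (A + 1) * (B + 1) - 1 = A * B + A + B := by
      have : (A + 1) * (B + 1) = A * B + A + B + 1 := by ring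
      omega
    rw [hA, hB, h3, Nat.add_sub_cancel, Nat.add_sub_cancel]
    ring
  have hsq : SqK n (2 ^ j) (monomial (ev e) 1) ∈ WW n d := by
    refine Submodule.mem_sup_left (Submodule.subset_span ⟨2 ^ j, Nat.one_le_two_pow, ?_, _, rfl⟩)
    exact Nat.pow_lt_pow_right (by norm_num) hj
  rw [SqK_monomial] at hsq
  set F : (Fin n → ℕ) → P n := fun c =>
    monomial (ev (e + c)) (∏ i, ((e i).choose (c i) : ZMod 2)) with hF
  have hinj : Function.Injective (fun a : Fin n => (Pi.single a (2 ^ j) : Fin n → ℕ)) := by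
    intro a b hab
    by_contra hne
    have := congrFun hab a
    simp [hne] at this
  set I := Finset.univ.map ⟨_, hinj⟩ with hI
  have hsub : I ⊆ Finset.piAntidiag Finset.univ (2 ^ j) := by
    intro c hc
    simp only [hI, Finset.mem_map, Finset.mem_univ, true_and, Function.Embedding.coeFn_mk] at hc
    obtain ⟨a, rfl⟩ := hc
    simp
  rw [← Finset.sum_sdiff hsub] at hsq
  have hrest : ∑ c ∈ Finset.piAntidiag Finset.univ (2 ^ j) \ I, F c ∈ WW n d := by
    refine Submodule.sum_mem _ fun c hc => ?_
    rw [Finset.mem_sdiff, Finset.mem_piAntidiag] at hc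
    obtain ⟨⟨hsum, -⟩, hcI⟩ := hc
    by_cases hz : ∏ i, ((e i).choose (c i) : ZMod 2) = 0
    · simp [hF, hz]
    have hne := fun i => (Finset.prod_ne_zero_iff.1 hz) i (Finset.mem_univ i)
    have hex0 : ∃ i, ¬ 2 ^ j ∣ c i := by
      by_contra hall
      push Not at hall
      have hpos : 0 < ∑ i, c i := by rw [hsum]; positivity
      obtain ⟨a, -, ha⟩ := Finset.exists_ne_zero_of_sum_ne_zero hpos.ne'
      apply hcI
      simp only [hI, Finset.mem_map, Finset.mem_univ, true_and, Function.Embedding.coeFn_mk]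
      refine ⟨a, ?_⟩
      have h1 := Nat.le_of_dvd (Nat.pos_of_ne_zero ha) (hall a)
      rw [← Finset.add_sum_erase _ _ (Finset.mem_univ a)] at hsum
      have h2 : ∑ x ∈ Finset.univ.erase a, c x = 0 := by omega
      rw [Finset.sum_eq_zero_iff] at h2
      funext i
      by_cases hi : i = a
      · subst hi; simp; omega
      · rw [Pi.single_eq_of_ne hi, h2 i (by simp [hi])]
    have hex : ∃ b, ∃ i, ¬ 2 ^ (b + 1) ∣ c i := by
      obtain ⟨i, hi⟩ := hex0
      exact ⟨j, i, fun h => hi ((pow_dvd_pow 2 (Nat.le_succ j)).trans h)⟩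
    obtain ⟨b, ⟨i, hi⟩, hbmin⟩ : ∃ b, (∃ i, ¬ 2 ^ (b + 1) ∣ c i) ∧ ∀ i, 2 ^ b ∣ c i := by
      refine ⟨Nat.find hex, Nat.find_spec hex, fun i => ?_⟩
      rcases Nat.eq_zero_or_pos (Nat.find hex) with h0 | h0
      · rw [h0]; simp
      · have := Nat.find_min hex (m := Nat.find hex - 1) (by omega)
        push Not at this
        have := this i
        rwa [Nat.sub_add_cancel h0] at this
    have hbj : b < j := by
      by_contra hge
      obtain ⟨i', hi'⟩ := hex0
      exact hi' ((pow_dvd_pow 2 (by omega)).trans (hbmin i'))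
    have hbit : ∀ b' < b, ∀ k, (e k + c k) / 2 ^ b' % 2 = e k / 2 ^ b' % 2 := by
      intro b' hb' k
      obtain ⟨q, hq⟩ := hbmin k
      have : c k = 2 ^ b' * (2 * (2 ^ (b - b' - 1) * q)) := by
        rw [hq]
        have : b = b' + 1 + (b - b' - 1) := by omega
        conv_lhs => rw [this, pow_add, pow_succ]
        ring
      rw [this, Nat.add_mul_div_left _ _ (by positivity)]
      omega
    have hbit' : ∀ k, (e k + c k) / 2 ^ b % 2 = (e k / 2 ^ b + c k / 2 ^ b) % 2 := by
      intro k
      obtain ⟨q, hq⟩ := hbmin k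
      rw [hq, Nat.add_mul_div_left _ _ (by positivity), Nat.mul_div_cancel_left _ (by positivity)]
    have hstep : ∀ k, c k / 2 ^ b % 2 = 1 → e k / 2 ^ b % 2 = 1 := by
      intro k hk
      by_contra h0
      apply hne k
      obtain ⟨q, hq⟩ := hbmin k
      rw [hq, Nat.mul_div_cancel_left _ (by positivity)] at hk
      rw [hq, choose_pow_mul, choose_odd _ _ hk (by omega)]
    have hci : c i / 2 ^ b % 2 = 1 := by
      by_contra h0
      apply hi
      obtain ⟨q, hq⟩ := hbmin i
      rw [hq, Nat.mul_div_cancel_left _ (by positivity)] at h0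
      rw [hq, pow_succ]
      exact Nat.mul_dvd_mul_left _ (by omega)
    have hlb : ∀ b' < j, e (m b') / 2 ^ b' % 2 = 0 := by
      intro b' hb'
      rw [he]
      simp [lowOf_bit m j b' _ hb']
    have hmem : (monomial (ev (e + c)) 1 : P n) ∈ WW n d := by
      have hmb : c (m b) / 2 ^ b % 2 = 0 := by
        by_contra h0
        have := hstep (m b) (by omega)
        have := hlb b hbj
        omega
      have hz1 : (e (m b) + c (m b)) / 2 ^ b % 2 = 0 := by
        have := hlb b hbj
        rw [hbit']; omega
      refine low_mem _ ?_ b (by omega) ?_ ?_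
      · simp only [ev_apply, Pi.add_apply, Finset.sum_add_distrib]
        rw [← hD, ← hsum]
      · intro b' hb'
        apply wt_le_of_zero _ _ (m b')
        simp only [ev_apply, Pi.add_apply]
        rcases hb'.lt_or_eq with hlt | rfl
        · rw [hbit b' hlt, hlb b' (by omega)]
        · exact hz1
      · apply wt_lt_of_zero _ _ (m b) i
        · rintro rfl
          omega
        · exact hz1
        · simp only [ev_apply, Pi.add_apply]
          have := hstep i hci
          rw [hbit']; omega
    have : F c = (∏ i, ((e i).choose (c i) : ZMod 2)) • (monomial (ev (e + c)) 1 : P n) := by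
      rw [hF, smul_monomial, smul_eq_mul, mul_one]
    rw [this]
    exact Submodule.smul_mem _ _ hmem
  have hmain := (Submodule.add_mem_iff_right _ hrest).1 hsq
  rw [hI, Finset.sum_map] at hmain
  convert hmain using 2 with a
  simp only [Function.Embedding.coeFn_mk]
  rw [Finset.prod_eq_single a (fun i _ hi => by simp [Pi.single_eq_of_ne hi]) (by simp),
    Pi.single_eq_same, choose_two_pow]
  have h1 : e a / 2 ^ j % 2 = g a % 2 := by
    have hlt : lowOf m j a < 2 ^ j := by
      have : lowOf m j a ≤ ∑ b ∈ Finset.range j, 2 ^ b :=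
        Finset.sum_le_sum fun b _ => by split_ifs <;> simp
      rw [Nat.geomSum_eq (le_refl 2)] at this
      have := Nat.one_le_two_pow (n := j)
      omega
    rw [he]
    simp only
    rw [Nat.add_mul_div_left _ _ (by positivity), Nat.div_eq_of_lt hlt, zero_add]
  rw [h1]
  split_ifs
  · unfold NN
    refine congrArg (fun v => (monomial (ev v) 1 : P n)) ?_
    funext k
    simp only [he, Pi.add_apply, Pi.single_apply]
    split_ifs <;> ring
  · simp

theorem pow_split (n j t : ℕ) :
    (n - 1) * (2 ^ j - 1) + 2 ^ j * ((n - 1) * (2 ^ t - 1) + 2 ^ t)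
      = (n - 1) * (2 ^ (j + t) - 1) + 2 ^ (j + t) := by
  rw [pow_add]
  obtain ⟨A, hA⟩ : ∃ A, 2 ^ j = A + 1 := ⟨2 ^ j - 1, (Nat.sub_add_cancel Nat.one_le_two_pow).symm⟩
  obtain ⟨B, hB⟩ : ∃ B, 2 ^ t = B + 1 := ⟨2 ^ t - 1, (Nat.sub_add_cancel Nat.one_le_two_pow).symm⟩
  have h3 : (A + 1) * (B + 1) - 1 = A * B + A + B := by
    have : (A + 1) * (B + 1) = A * B + A + B + 1 := by ring
    omega
  rw [hA, hB, h3, Nat.add_sub_cancel, Nat.add_sub_cancel]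
  ring

theorem lowOf_lt {n : ℕ} (m : ℕ → Fin n) (j : ℕ) (a : Fin n) : lowOf m j a < 2 ^ j := by
  have : lowOf m j a ≤ ∑ b ∈ Finset.range j, 2 ^ b :=
    Finset.sum_le_sum fun b _ => by split_ifs <;> simp
  rw [Nat.geomSum_eq (le_refl 2)] at this
  have := Nat.one_le_two_pow (n := j)
  omega

theorem bit_high {n : ℕ} (m : ℕ → Fin n) (j b z : ℕ) (k : Fin n) :
    (lowOf m j k + 2 ^ j * z) / 2 ^ (j + b) = z / 2 ^ b := by
  rw [pow_add, ← Nat.div_div_eq_div_mul, Nat.add_mul_div_left _ _ (by positivity),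
    Nat.div_eq_of_lt (lowOf_lt m j k), zero_add]

theorem NN_low {n j t : ℕ} (m : ℕ → Fin n) (h : Fin n → ℕ)
    (hdeg : ∑ k, h k = (n - 1) * (2 ^ t - 1) + 2 ^ t) (b0 : ℕ) (hb0 : b0 < t)
    (h1 : ∀ b ≤ b0, ∃ k, h k / 2 ^ b % 2 = 0) (k k' : Fin n) (hk : k ≠ k')
    (hz : h k / 2 ^ b0 % 2 = 0) (hz' : h k' / 2 ^ b0 % 2 = 0) : NN m j h ∈ WW n (j + t) := by
  refine low_mem _ ?_ (j + b0) (by omega) ?_ ?_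
  · simp only [ev_apply, Finset.sum_add_distrib, sum_lowOf]
    rw [← Finset.mul_sum, hdeg, pow_split]
  · intro b hb
    by_cases hbj : b < j
    · refine wt_le_of_zero _ _ (m b) ?_
      rw [ev_apply, lowOf_bit m j b _ hbj, if_pos rfl]
    · obtain ⟨c, rfl⟩ : ∃ c, b = j + c := ⟨b - j, by omega⟩
      obtain ⟨k, hk⟩ := h1 c (by omega)
      refine wt_le_of_zero _ _ k ?_
      rw [ev_apply, bit_high, hk]
  · refine wt_lt_of_zero _ _ k k' hk ?_ ?_
    · rw [ev_apply, bit_high, hz]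
    · rw [ev_apply, bit_high, hz']

theorem NN_low2 {n j t : ℕ} (m : ℕ → Fin n) (h : Fin n → ℕ)
    (hdeg : ∑ k, h k = (n - 1) * (2 ^ t - 1) + 2 ^ t)
    (h1 : ∀ b < t, ∃ k, h k / 2 ^ b % 2 = 0) (h2 : 2 ≤ ∑ k, h k / 2 ^ t) :
    NN m j h ∈ WW n (j + t) := by
  refine low_mem2 _ ?_ ?_ ?_
  · simp only [ev_apply, Finset.sum_add_distrib, sum_lowOf]
    rw [← Finset.mul_sum, hdeg, pow_split]
  · intro b hb
    by_cases hbj : b < j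
    · refine wt_le_of_zero _ _ (m b) ?_
      rw [ev_apply, lowOf_bit m j b _ hbj, if_pos rfl]
    · obtain ⟨c, rfl⟩ : ∃ c, b = j + c := ⟨b - j, by omega⟩
      obtain ⟨k, hk⟩ := h1 c (by omega)
      refine wt_le_of_zero _ _ k ?_
      rw [ev_apply, bit_high, hk]
  · simpa only [ev_apply, bit_high] using h2

def pr (n d : ℕ) : P n →ₗ[ZMod 2] (P n ⧸ WW n d) := (WW n d).mkQ

theorem pr_zero {n d : ℕ} {f : P n} : pr n d f = 0 ↔ f ∈ WW n d := by
  simp [pr]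

theorem add_self_zero {n d : ℕ} (x : P n ⧸ WW n d) : x + x = 0 := ZModModule.add_self x

theorem eq_of_add_zero {n d : ℕ} {x y : P n ⧸ WW n d} (h : x + y = 0) : x = y := by
  have h2 := add_self_zero y
  exact add_right_cancel (h.trans h2.symm)

theorem two_term {n j t : ℕ} (hnd : n ≤ j + t) (m : ℕ → Fin n) (hj : j < n) (g : Fin n → ℕ)
    (hdeg : ∑ k, g k + 1 = (n - 1) * (2 ^ t - 1) + 2 ^ t) (b c : Fin n) (hbc : b ≠ c)
    (hb : g b % 2 = 1) (hc : g c % 2 = 1)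
    (hother : ∀ a, a ≠ b → a ≠ c → g a % 2 = 1 → NN m j (g + Pi.single a 1) ∈ WW n (j + t)) :
    pr n (j + t) (NN m j (g + Pi.single b 1)) = pr n (j + t) (NN m j (g + Pi.single c 1)) := by
  have hk := key hnd m j hj g (by rw [Nat.add_sub_cancel_left]; exact hdeg)
  rw [← pr_zero, map_sum, ← Finset.add_sum_erase _ _ (Finset.mem_univ b),
    ← Finset.add_sum_erase _ _ (show c ∈ Finset.univ.erase b by simp [hbc.symm]),
    Finset.sum_eq_zero, add_zero, if_pos hb, if_pos hc] at hk
  · exact eq_of_add_zero hk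
  · intro a ha
    simp only [Finset.mem_erase, Finset.mem_univ, and_true] at ha
    split_ifs with h
    · exact pr_zero.2 (hother a ha.2 ha.1 h)
    · simp

def MO {n : ℕ} (d : ℕ) (m : ℕ → Fin n) (s : Fin n) : P n := NN m d (Pi.single s 1)

theorem MO_split {n : ℕ} (j t : ℕ) (m : ℕ → Fin n) (s : Fin n) :
    MO (j + t) m s
      = NN m j (fun k => lowOf (fun b => m (j + b)) t k + 2 ^ t * Pi.single (M := fun _ => ℕ) s 1 k) := by
  unfold MO NN
  refine congrArg (fun v => (monomial (ev v) 1 : P n)) ?_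
  funext k
  simp only [lowOf_split m j t k, pow_add]
  ring

theorem NN_congr {n : ℕ} (m m' : ℕ → Fin n) (j : ℕ) (g g' : Fin n → ℕ) (h : ∀ b < j, m b = m' b)
    (hg : ∀ k, g k = g' k) : NN m j g = NN m' j g' := by
  unfold NN
  refine congrArg (fun v => (monomial (ev v) 1 : P n)) ?_
  funext k
  rw [lowOf_congr m m' j h, hg]

theorem MO_congr {n : ℕ} (d : ℕ) (m m' : ℕ → Fin n) (s : Fin n) (h : ∀ b < d, m b = m' b) :
    MO d m s = MO d m' s := NN_congr _ _ _ _ _ h fun _ => rfl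

theorem MO_deg {n : ℕ} (m : ℕ → Fin n) (t : ℕ) (s : Fin n) :
    ∑ k, (lowOf m t k + 2 ^ t * Pi.single (M := fun _ => ℕ) s 1 k)
      = (n - 1) * (2 ^ t - 1) + 2 ^ t := by
  rw [Finset.sum_add_distrib, sum_lowOf, ← Finset.mul_sum]
  simp

theorem swap_lemma {n d : ℕ} (hnd : n ≤ d) (m m' : ℕ → Fin n) (s : Fin n) (j : ℕ) (hj : j + 1 < n)
    (h0 : m' j = m (j + 1)) (h1 : m' (j + 1) = m j) (h2 : ∀ b, b ≠ j → b ≠ j + 1 → m' b = m b) :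
    pr n d (MO d m s) = pr n d (MO d m' s) := by
  by_cases hne : m j = m (j + 1)
  · refine congrArg _ (MO_congr _ _ _ _ fun b _ => ?_)
    by_cases hb : b = j
    · rw [hb, h0, hne]
    by_cases hb' : b = j + 1
    · rw [hb', h1, hne]
    rw [h2 b hb hb']
  obtain ⟨t, rfl⟩ : ∃ t, d = j + (2 + t) := ⟨d - j - 2, by omega⟩
  rw [MO_split, MO_split]
  have e2 : ∀ (f : ℕ → Fin n) k, lowOf f 2 k =
      (if f 0 = k then 0 else 1) + (if f 1 = k then 0 else 2) := by
    intro f k; simp [lowOf, Finset.sum_range_succ]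
  set z : Fin n → ℕ := fun k =>
    lowOf (fun b => m (j + (2 + b))) t k + 2 ^ t * Pi.single (M := fun _ => ℕ) s 1 k with hz
  set b := m j with hb
  set c := m (j + 1) with hc
  set g : Fin n → ℕ := fun k => 4 * z k + if k = b then 1 else if k = c then 1 else 3 with hg
  have hA : ∀ k, lowOf (fun b => m (j + b)) (2 + t) k + 2 ^ (2 + t) * Pi.single (M := fun _ => ℕ) s 1 k
      = (g + Pi.single b 1 : Fin n → ℕ) k := by
    intro k
    rw [lowOf_split, e2, pow_add]
    simp only [hg, Pi.add_apply, Pi.single_apply, hz, add_zero, ← hb, ← hc, eq_comm (b := k)]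
    have hne' : c ≠ b := fun h => hne h.symm
    split_ifs <;> first | omega | (subst_vars; contradiction) 
  have hB : ∀ k, lowOf (fun b => m' (j + b)) (2 + t) k + 2 ^ (2 + t) * Pi.single (M := fun _ => ℕ) s 1 k
      = (g + Pi.single c 1 : Fin n → ℕ) k := by
    intro k
    have : lowOf (fun b => m' (j + (2 + b))) t k = lowOf (fun b => m (j + (2 + b))) t k :=
      lowOf_congr _ _ _ (fun b _ => h2 _ (by omega) (by omega)) _
    rw [lowOf_split, e2, pow_add, this]
    simp only [hg, Pi.add_apply, Pi.single_apply, hz, add_zero, h0, h1, eq_comm (b := k)]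
    have hne' : c ≠ b := fun h => hne h.symm
    split_ifs <;> first | omega | (subst_vars; contradiction) 
  rw [NN_congr _ _ _ _ _ (fun _ _ => rfl) hA,
    NN_congr m' m j _ _ (fun b hb => h2 b (by omega) (by omega)) hB]
  have hdg : ∑ k, g k + 1 = (n - 1) * (2 ^ (2 + t) - 1) + 2 ^ (2 + t) := by
    rw [← MO_deg (fun b => m (j + b)) (2 + t) s, Finset.sum_congr rfl fun k _ => hA k]
    simp [Finset.sum_add_distrib]
  refine two_term hnd m (by omega) g hdg b c hne ?_ ?_ ?_
  · simp only [hg]; simp; omega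
  · simp only [hg]; simp; omega
  · intro a hab hac _
    have hga : g a = 4 * z a + 3 := by simp [hg, hab, hac]
    have hgb : g b = 4 * z b + 1 := by simp [hg]
    have hgc : g c = 4 * z c + 1 := by simp [hg]
    refine NN_low m _ ?_ 1 (by omega) ?_ b c hne ?_ ?_
    · rw [← hdg]; simp [Finset.sum_add_distrib]
    · intro x hx
      refine ⟨a, ?_⟩
      simp only [Pi.add_apply, Pi.single_eq_same, hga]
      interval_cases x <;> simp <;> omega
    · simp only [Pi.add_apply, Pi.single_eq_of_ne (Ne.symm hab), hgb]; omega
    · simp only [Pi.add_apply, Pi.single_eq_of_ne (Ne.symm hac), hgc]; omega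

def hG {n : ℕ} (b c s : Fin n) (t q : ℕ) : Fin n → ℕ := fun k =>
  (if k = b then q else if k = c then 2 ^ t - 1 - q else 2 ^ t - 1) + 2 ^ t * Pi.single (M := fun _ => ℕ) s 1 k

theorem sum_two {n : ℕ} (b c : Fin n) (hbc : b ≠ c) (x y z : ℕ) :
    ∑ k : Fin n, (if k = b then x else if k = c then y else z) = x + y + (n - 2) * z := by
  have hc : c ∈ Finset.univ.erase b := by simp [hbc.symm]
  rw [← Finset.add_sum_erase _ _ (Finset.mem_univ b), ← Finset.add_sum_erase _ _ hc,
    if_pos rfl, if_neg hbc.symm, if_pos rfl, Finset.sum_congr rfl (g := fun _ => z)]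
  · rw [Finset.sum_const, Finset.card_erase_of_mem hc, Finset.card_erase_of_mem (Finset.mem_univ b)]
    simp [add_assoc, Nat.sub_sub]
  · intro k hk
    simp only [Finset.mem_erase, Finset.mem_univ, and_true] at hk
    rw [if_neg hk.2, if_neg hk.1]

theorem odd_step {n j t : ℕ} (hnd : n ≤ j + t) (hj : j < n) (m : ℕ → Fin n) (b c s : Fin n)
    (hbc : b ≠ c) (q : ℕ) (hq : q % 2 = 1) (hqt : q + 3 ≤ 2 ^ t) :
    pr n (j + t) (NN m j (hG b c s t q)) = pr n (j + t) (NN m j (hG b c s t (q + 1))) := by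
  have hn2 : 2 ≤ n := by
    have := b.isLt; have := c.isLt
    by_contra h
    exact hbc (Fin.ext (by omega))
  obtain ⟨t, rfl⟩ : ∃ t', t = t' + 1 := by
    cases t with
    | zero => simp at hqt
    | succ t => exact ⟨t, rfl⟩
  have hev : 2 ^ (t + 1) = 2 * 2 ^ t := pow_succ' 2 t
  set K := 2 ^ (t + 1) with hK
  set g : Fin n → ℕ := fun k =>
    (if k = b then q else if k = c then K - 2 - q else K - 1) + K * Pi.single (M := fun _ => ℕ) s 1 k with hg
  have hdg : ∑ k, g k + 1 = (n - 1) * (K - 1) + K := by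
    simp only [hg]
    rw [Finset.sum_add_distrib, sum_two b c hbc, ← Finset.mul_sum]
    simp only [Finset.sum_pi_single', Finset.mem_univ, if_true]
    obtain ⟨n', rfl⟩ : ∃ n', n = n' + 2 := ⟨n - 2, by omega⟩
    simp only [Nat.add_sub_cancel]
    have : (n' + 2 - 1) * (K - 1) = n' * (K - 1) + (K - 1) := by
      rw [show n' + 2 - 1 = n' + 1 by omega]; ring
    rw [this]
    omega
  have hA : hG b c s (t + 1) q = g + Pi.single c 1 := by
    funext k
    simp only [hG, hg, Pi.add_apply, ← hK]
    by_cases h1 : k = c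
    · subst h1; simp [hbc.symm]; omega
    · simp [h1]
  have hB : hG b c s (t + 1) (q + 1) = g + Pi.single b 1 := by
    funext k
    simp only [hG, hg, Pi.add_apply, ← hK]
    by_cases h1 : k = b
    · subst h1; simp; omega
    · simp only [h1, if_false, Pi.single_eq_of_ne (show k ≠ b from h1)]
      split_ifs <;> omega
  have hKs : ∀ k : Fin n, (K * Pi.single (M := fun _ => ℕ) s 1 k) % 2 = 0 := by
    intro k; rw [hev, mul_assoc]; simp
  rw [hA, hB]
  symm
  refine two_term hnd m hj g hdg b c hbc ?_ ?_ ?_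
  · have := hKs b
    simp only [hg]; simp only [if_true]; omega
  · have := hKs c
    simp only [hg]; simp only [if_true, hbc.symm, if_false]; omega
  · intro a hab hac _
    have hga : (g + Pi.single a 1 : Fin n → ℕ) a = K * (1 + Pi.single (M := fun _ => ℕ) s 1 a) := by
      simp only [hg, Pi.add_apply, hab, hac, if_false, Pi.single_eq_same]
      rw [mul_add]; omega
    refine NN_low2 m _ ?_ ?_ ?_
    · rw [← hdg]; simp [Finset.sum_add_distrib]
    · intro x hx
      refine ⟨a, ?_⟩
      rw [hga, hK]
      obtain ⟨y, hy⟩ : ∃ y, t + 1 = x + (y + 1) := ⟨t - x, by omega⟩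
      rw [hy, pow_add, mul_assoc, Nat.mul_div_cancel_left _ (by positivity), pow_succ', mul_assoc]
      simp
    · rw [← hK]
      have hKpos : 0 < K := by omega
      have hle : ∀ k, (Pi.single (M := fun _ => ℕ) a 1 k + Pi.single (M := fun _ => ℕ) s 1 k)
          ≤ (g + Pi.single a 1 : Fin n → ℕ) k / K := by
        intro k
        by_cases hk : k = a
        · subst hk
          rw [hga, Nat.mul_div_cancel_left _ hKpos]; simp
        · rw [Nat.le_div_iff_mul_le hKpos]
          simp only [hg, Pi.add_apply, Pi.single_eq_of_ne hk]
          rw [zero_add, mul_comm]; omega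
      refine le_trans ?_ (Finset.sum_le_sum fun k _ => hle k)
      simp [Finset.sum_add_distrib]

theorem NN_absorb {n : ℕ} (m : ℕ → Fin n) (j : ℕ) (g : Fin n → ℕ) (x : Fin n) :
    NN (Function.update m j x) (j + 1) g = NN m j (fun k => 2 * g k + if x = k then 0 else 1) := by
  unfold NN
  refine congrArg (fun v => (monomial (ev v) 1 : P n)) ?_
  funext k
  rw [lowOf_succ, Function.update_self, lowOf_congr (Function.update m j x) m j
    (fun b hb => Function.update_of_ne (by omega) _ _), pow_succ]
  beta_reduce
  split_ifs <;> ring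

theorem hG_even {n : ℕ} (m : ℕ → Fin n) (j : ℕ) (b c s : Fin n) (hbc : b ≠ c) (t q : ℕ)
    (hq : q < 2 ^ t) :
    NN m j (hG b c s (t + 1) (2 * q)) = NN (Function.update m j b) (j + 1) (hG b c s t q) := by
  rw [NN_absorb]
  refine NN_congr _ _ _ _ _ (fun _ _ => rfl) fun k => ?_
  simp only [hG, pow_succ]
  by_cases h1 : k = b
  · subst h1; simp; ring
  · have h1' : ¬ b = k := fun h => h1 h.symm
    have : 2 ^ t * 2 * Pi.single (M := fun _ => ℕ) s 1 k
      = 2 * (2 ^ t * Pi.single (M := fun _ => ℕ) s 1 k) := by ring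
    rw [this]
    simp only [h1, h1', if_false]
    split_ifs <;> omega

theorem hG_odd {n : ℕ} (m : ℕ → Fin n) (j : ℕ) (b c s : Fin n) (hbc : b ≠ c) (t q : ℕ)
    (hq : q < 2 ^ t) :
    NN m j (hG b c s (t + 1) (2 * q + 1))
      = NN (Function.update m j c) (j + 1) (hG b c s t q) := by
  rw [NN_absorb]
  refine NN_congr _ _ _ _ _ (fun _ _ => rfl) fun k => ?_
  simp only [hG, pow_succ]
  have : 2 ^ t * 2 * Pi.single (M := fun _ => ℕ) s 1 k
      = 2 * (2 ^ t * Pi.single (M := fun _ => ℕ) s 1 k) := by ring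
  rw [this]
  by_cases h1 : k = b
  · subst h1; simp [hbc.symm]; ring
  · by_cases h2 : k = c
    · subst h2; simp [h1]; omega
    · have h2' : ¬ c = k := fun h => h2 h.symm
      simp only [h1, h2, h2', if_false]
      omega

theorem pair_chain {n j t : ℕ} (hnd : n ≤ j + (t + 1)) (hj : j + 1 < n) (m : ℕ → Fin n)
    (b c s : Fin n) (hbc : b ≠ c) (q : ℕ) (hq1 : 1 ≤ q) (hqt : q + 2 ≤ 2 ^ (t + 1)) :
    pr n (j + (t + 1)) (NN m j (hG b c s (t + 1) q))
      = pr n (j + (t + 1)) (NN m j (hG b c s (t + 1) 1)) := by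
  have hS : ∀ (m' : ℕ → Fin n) (q' : ℕ), q' % 2 = 1 → q' + 3 ≤ 2 ^ t →
      pr n (j + (t + 1)) (NN m' (j + 1) (hG b c s t q'))
        = pr n (j + (t + 1)) (NN m' (j + 1) (hG b c s t (q' + 1))) := by
    intro m' q' h1 h2
    have := odd_step (j := j + 1) (t := t) (by omega) hj m' b c s hbc q' h1 h2
    rwa [show j + 1 + t = j + (t + 1) by omega] at this
  have ht1 : 1 ≤ t := by omega
  obtain ⟨t, rfl⟩ : ∃ t', t = t' + 1 := ⟨t - 1, by omega⟩
  have hp1 : 2 ^ (t + 1) = 2 * 2 ^ t := pow_succ' 2 t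
  have hp2 : 2 ^ (t + 1 + 1) = 2 * (2 * 2 ^ t) := by rw [pow_succ', hp1]
  induction q, hq1 using Nat.le_induction with
  | base => rfl
  | succ q hq ih =>
    have ih := ih (by omega)
    rw [← ih]
    symm
    by_cases ho : q % 2 = 1
    · exact odd_step hnd (by omega) m b c s hbc q ho (by omega)
    by_cases h4 : q % 4 = 2
    · obtain ⟨x, rfl⟩ : ∃ x, q = 2 * x := ⟨q / 2, by omega⟩
      have h1 := hS (Function.update m j b) x (by omega) (by omega)
      rw [← hG_even m j b c s hbc _ x (by omega),
        ← hG_even m j b c s hbc _ (x + 1) (by omega)] at h1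
      have h2 := odd_step hnd (by omega) m b c s hbc (2 * x + 1) (by omega) (by omega)
      rw [h1, h2]
      rfl
    · obtain ⟨x, rfl⟩ : ∃ x, q = 2 * x + 2 := ⟨q / 2 - 1, by omega⟩
      have h1 := hS (Function.update m j c) x (by omega) (by omega)
      rw [← hG_odd m j b c s hbc _ x (by omega),
        ← hG_odd m j b c s hbc _ (x + 1) (by omega)] at h1
      have h2 := odd_step hnd (by omega) m b c s hbc (2 * x + 1) (by omega) (by omega)
      rw [show 2 * x + 2 = 2 * x + 1 + 1 by omega, ← h2, h1]
      rfl

theorem C_lemma {n d : ℕ} (hnd : n ≤ d) (p : ℕ) (hp : p < n) (m : ℕ → Fin n) :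
    ∑ a : Fin n, pr n d (MO d (fun b => if b < p then m b else a) a) = 0 := by
  obtain ⟨t, rfl⟩ : ∃ t, d = p + (t + 1) := ⟨d - p - 1, by omega⟩
  have hK : 2 ^ (t + 1) = 2 * 2 ^ t := pow_succ' 2 t
  have hpos : 0 < 2 ^ t := by positivity
  have hk := key hnd m p hp (fun _ => 2 ^ (t + 1) - 1) (by
    rw [Nat.add_sub_cancel_left]
    simp only [Finset.sum_const, Finset.card_univ, Fintype.card_fin, smul_eq_mul]
    obtain ⟨n', rfl⟩ : ∃ n', n = n' + 1 := ⟨n - 1, by omega⟩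
    rw [Nat.add_sub_cancel, Nat.succ_mul]; omega)
  rw [← pr_zero, map_sum] at hk
  rw [← hk]
  refine Finset.sum_congr rfl fun a _ => congrArg _ ?_
  rw [if_pos (by omega), MO_split]
  refine NN_congr _ _ _ _ _ (fun b hb => by simp [hb]) fun k => ?_
  have : (fun b => if p + b < p then m (p + b) else a) = fun _ => a := by
    funext b; simp
  rw [this, lowOf_const]
  by_cases h : a = k
  · subst h; simp; omega
  · simp [h, Pi.single_eq_of_ne (Ne.symm h)]

theorem pair_seq {n d : ℕ} (hnd : n ≤ d) (j : ℕ) (hj : j + 1 < n) (m m' : ℕ → Fin n) (b c s : Fin n)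
    (h0 : ∀ x < j, m x = m' x) (h1 : m j = b) (h2 : ∀ x, j < x → m x = c)
    (h3 : m' j = c) (h4 : ∀ x, j < x → m' x = b) : pr n d (MO d m s) = pr n d (MO d m' s) := by
  by_cases hbc : b = c
  · refine congrArg _ (MO_congr _ _ _ _ fun x _ => ?_)
    rcases lt_trichotomy x j with h | h | h
    · exact h0 x h
    · rw [h, h1, h3, hbc]
    · rw [h2 x h, h4 x h, hbc]
  obtain ⟨t, rfl⟩ : ∃ t, d = j + (t + 1) := ⟨d - j - 1, by omega⟩
  have hK : 2 ^ (t + 1) = 2 * 2 ^ t := pow_succ' 2 t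
  have hp2 : 2 ≤ 2 ^ t := by
    calc 2 = 2 ^ 1 := rfl
      _ ≤ 2 ^ t := Nat.pow_le_pow_right (by norm_num) (by omega)
  have hl : ∀ (f : ℕ → Fin n) (u v : Fin n), f j = u → (∀ x, j < x → f x = v) → ∀ k,
      lowOf (fun x => f (j + x)) (t + 1) k = (if u = k then 0 else 1) + 2 * (if v = k then 0 else 2 ^ t - 1) := by
    intro f u v hu hv k
    rw [add_comm t 1, lowOf_split]
    have : (fun b => f (j + (1 + b))) = fun _ => v := by
      funext x; exact hv _ (by omega)
    rw [this, lowOf_const]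
    simp [lowOf, hu]
  have := pair_chain hnd hj m b c s hbc (2 ^ (t + 1) - 2) (by omega) (by omega)
  rw [MO_split, MO_split, NN_congr m m j _ (hG b c s (t + 1) (2 ^ (t + 1) - 2)) (fun _ _ => rfl),
    NN_congr m' m j _ (hG b c s (t + 1) 1) (fun x hx => (h0 x hx).symm), this]
  · intro k
    rw [hl m' c b h3 h4, hG]
    simp only [eq_comm (b := k)]
    congr 1
    by_cases hk : k = b
    · subst hk; simp [hbc]
    · by_cases hk' : k = c
      · simp [hk', Ne.symm hbc, hk]; omega
      · simp [hk, hk']; omega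
  · intro k
    rw [hl m b c h1 h2, hG]
    simp only [eq_comm (b := k)]
    congr 1
    by_cases hk : k = b
    · subst hk; simp [hbc]; omega
    · by_cases hk' : k = c
      · simp [hk', Ne.symm hbc, hk]; omega
      · simp [hk, hk']; omega

def lab (n : ℕ) (hn : 0 < n) (k : ℕ) : Fin n := ⟨(k - 1) % n, Nat.mod_lt _ hn⟩

def mono (n d : ℕ) (hn : 0 < n) (l : List ℕ) (a s : ℕ) : P n :=
  MO d (fun b => lab n hn (l.getD b a)) (lab n hn s)

theorem mono_perm {n d : ℕ} (hn : 0 < n) (hnd : n ≤ d) (a s : ℕ) {l l' : List ℕ} (h : l.Perm l') :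
    ∀ p : List ℕ, p.length + l.length ≤ n →
      pr n d (mono n d hn (p ++ l) a s) = pr n d (mono n d hn (p ++ l') a s) := by
  induction h with
  | nil => intros; rfl
  | cons x _ ih =>
    intro p hp
    have := ih (p ++ [x]) (by simp at hp ⊢; omega)
    simpa using this
  | swap x y l =>
    intro p hp
    refine swap_lemma hnd _ _ _ p.length (by simp at hp; omega) ?_ ?_ ?_
    · simp [List.getElem?_append]
    · simp [List.getElem?_append]
    · intro b h1 h2
      refine congrArg _ ?_
      rcases lt_or_ge b p.length with h | h
      · simp [List.getElem?_append, h]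
      · obtain ⟨c, rfl⟩ : ∃ c, b = p.length + (c + 2) := ⟨b - p.length - 2, by omega⟩
        simp [List.getElem?_append]
  | trans h1 _ ih1 ih2 =>
    intro p hp
    rw [ih1 p hp, ih2 p (by rwa [← h1.length_eq])]

theorem mono_perm' {n d : ℕ} (hn : 0 < n) (hnd : n ≤ d) (a s : ℕ) {l l' : List ℕ} (h : l.Perm l')
    (hl : l.length ≤ n) : pr n d (mono n d hn l a s) = pr n d (mono n d hn l' a s) := by
  simpa using mono_perm hn hnd a s h [] (by simpa using hl)

theorem mono_snoc {n d : ℕ} (hn : 0 < n) (a s : ℕ) (l : List ℕ) :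
    mono n d hn (l ++ [a]) a s = mono n d hn l a s := by
  refine MO_congr _ _ _ _ fun b _ => congrArg _ ?_
  rcases lt_trichotomy b l.length with h | h | h
  · simp [List.getElem?_append, h]
  · simp [h]
  · rw [List.getD_eq_default _ _ (by simp; omega), List.getD_eq_default _ _ (by omega)]

theorem mono_pair {n d : ℕ} (hn : 0 < n) (hnd : n ≤ d) (b c s : ℕ) (l : List ℕ)
    (hl : l.length + 1 < n) :
    pr n d (mono n d hn (l ++ [b]) c s) = pr n d (mono n d hn (l ++ [c]) b s) := by
  refine pair_seq hnd l.length hl _ _ (lab n hn b) (lab n hn c) _ ?_ ?_ ?_ ?_ ?_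
  · intro x hx; simp [List.getElem?_append, hx]
  · simp
  · intro x hx; rw [List.getD_eq_default _ _ (by simp; omega)]
  · simp
  · intro x hx; rw [List.getD_eq_default _ _ (by simp; omega)]

theorem mono_C {n d : ℕ} (hn : 0 < n) (hnd : n ≤ d) (l : List ℕ) (hl : l.length < n) :
    ∑ a ∈ Finset.Icc 1 n, pr n d (mono n d hn l a a) = 0 := by
  rw [← C_lemma hnd l.length hl (fun b => lab n hn (l.getD b 0))]
  refine Finset.sum_bij' (fun a _ => lab n hn a) (fun a _ => (a : ℕ) + 1) ?_ ?_ ?_ ?_ ?_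
  · simp
  · intro a _; simp
  · intro a ha
    simp only [Finset.mem_Icc] at ha
    simp only [lab]
    rw [Nat.mod_eq_of_lt (by omega)]; omega
  · intro a _
    apply Fin.ext
    simp [lab, Nat.mod_eq_of_lt a.isLt]
  · intro a _
    refine congrArg _ (MO_congr _ _ _ _ fun b _ => ?_)
    split_ifs with h
    · simp [h]
    · rw [List.getD_eq_default _ _ (by omega)]

theorem toList_insert_perm {S : Finset ℕ} {a : ℕ} (h : a ∉ S) :
    (insert a S).toList.Perm (S.toList ++ [a]) :=
  (Finset.toList_insert h).trans (List.perm_append_singleton a _).symm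

theorem sum_c {n d : ℕ} (hn : 0 < n) (hnd : n ≤ d) :
    ∑ S ∈ (Finset.Icc 1 (n - 1)).powerset, pr n d (mono n d hn S.toList n n) = 0 := by
  have hcard : ∀ S ∈ (Finset.Icc 1 (n - 1)).powerset, S.toList.length < n := by
    intro S hS
    have := Finset.card_le_card (Finset.mem_powerset.1 hS)
    simp at this ⊢
    omega
  have h1 : ∑ S ∈ (Finset.Icc 1 (n - 1)).powerset, ∑ a ∈ Finset.Icc 1 n,
      pr n d (mono n d hn S.toList a a) = 0 :=
    Finset.sum_eq_zero fun S hS => mono_C hn hnd _ (hcard S hS)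
  rw [Finset.sum_comm, ← Finset.add_sum_erase _ _ (show n ∈ Finset.Icc 1 n by simp; omega),
    Finset.sum_eq_zero (s := (Finset.Icc 1 n).erase n), add_zero] at h1
  · exact h1
  intro a ha
  have ha' : a ∈ Finset.Icc 1 (n - 1) := by
    simp only [Finset.mem_erase, Finset.mem_Icc] at ha ⊢; omega
  rw [← Finset.insert_erase ha', Finset.sum_powerset_insert (Finset.notMem_erase a _),
    ← Finset.sum_add_distrib]
  refine Finset.sum_eq_zero fun S hS => ?_
  have haS : a ∉ S := fun h => by simpa using Finset.mem_powerset.1 hS h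
  have hS' : S ∈ (Finset.Icc 1 (n - 1)).powerset :=
    Finset.mem_powerset.2 ((Finset.mem_powerset.1 hS).trans (Finset.erase_subset _ _))
  have hc := hcard S hS'
  rw [mono_perm' hn hnd a a (toList_insert_perm haS)
    (by rw [(toList_insert_perm haS).length_eq]; simp at hc ⊢; omega), mono_snoc]
  exact add_self_zero _

theorem sum_min {M : Type*} [AddCommMonoid M] (N : ℕ) (F : Finset ℕ → M) :
    ∑ S ∈ (Finset.Icc 1 N).powerset, F S
      = F ∅ + ∑ i ∈ Finset.Icc 1 N, ∑ S ∈ (Finset.Icc (i + 1) N).powerset, F (insert i S) := by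
  suffices h : ∀ k ≤ N + 1, ∑ S ∈ (Finset.Icc k N).powerset, F S
      = F ∅ + ∑ i ∈ Finset.Icc k N, ∑ S ∈ (Finset.Icc (i + 1) N).powerset, F (insert i S) from
    h 1 (by omega)
  intro k hk
  induction hk using Nat.decreasingInduction with
  | self => simp
  | of_succ k hk ih =>
    have e : Finset.Icc k N = insert k (Finset.Icc (k + 1) N) := by
      ext x; simp only [Finset.mem_insert, Finset.mem_Icc]; omega
    rw [e, Finset.sum_powerset_insert (by simp), Finset.sum_insert (by simp), ih]
    rw [add_assoc, add_comm (∑ i ∈ Finset.Icc (k + 1) N, _)]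

theorem step5 {n d : ℕ} (hn : 0 < n) (hnd : n ≤ d) (i : ℕ) (hi : 1 ≤ i) (hin : i ≤ n - 1)
    (S : Finset ℕ) (hS : S ⊆ Finset.Icc (i + 1) (n - 1)) :
    pr n d (mono n d hn (insert i S).toList n n)
      = pr n d (mono n d hn ((insert n S).sort (· ≤ ·)).reverse i n) := by
  have hiS : i ∉ S := fun h => by have := hS h; simp at this
  have hnS : n ∉ S := fun h => by have := hS h; simp at this; omega
  have hc := Finset.card_le_card hS
  simp at hc
  rw [mono_perm' hn hnd n n (toList_insert_perm hiS)
    (by rw [(toList_insert_perm hiS).length_eq]; simp; omega),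
    mono_pair hn hnd _ _ _ _ (by simp; omega)]
  refine mono_perm' hn hnd _ _ ?_ (by simp; omega)
  refine (toList_insert_perm hnS).symm.trans ?_
  refine List.Perm.trans ?_ (List.reverse_perm _).symm
  exact (Finset.sort_perm_toList _ _).symm

theorem lab_iff {n : ℕ} (hn : 0 < n) (x : ℕ) (h1 : 1 ≤ x) (h2 : x ≤ n) (k : Fin n) :
    lab n hn x = k ↔ x = (k : ℕ) + 1 := by
  rw [Fin.ext_iff, lab]
  simp only
  rw [Nat.mod_eq_of_lt (by omega)]
  omega

theorem xIu_eq (n : ℕ) (I : List ℕ) (hI : 1 ≤ I.length) (k : Fin n) :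
    xIuExp n I 1 k
      = ∑ b ∈ Finset.range I.length, if I.getD (I.length - 1 - b) 0 = (k : ℕ) + 1 then 2 ^ b else 0 := by
  have h1 : ∑ t ∈ Finset.Icc 1 I.length,
      (if I.getD (t - 1) 0 = (k : ℕ) + 1 then 2 ^ (I.length - t) else 0)
      = ∑ b ∈ Finset.range I.length, if I.getD (I.length - 1 - b) 0 = (k : ℕ) + 1 then 2 ^ b else 0 := by
    refine Finset.sum_bij' (fun t _ => I.length - t) (fun b _ => I.length - b) ?_ ?_ ?_ ?_ ?_
    · intro t ht; simp only [Finset.mem_Icc, Finset.mem_range] at ht ⊢; omega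
    · intro t ht; simp only [Finset.mem_Icc, Finset.mem_range] at ht ⊢; omega
    · intro t ht; simp only [Finset.mem_Icc] at ht ⊢; omega
    · intro t ht; simp only [Finset.mem_range] at ht ⊢; omega
    · intro t ht
      simp only [Finset.mem_Icc] at ht
      rw [show I.length - 1 - (I.length - t) = t - 1 by omega]
  rw [← h1, xIuExp]
  have e : Finset.Icc 1 I.length = insert 1 (Finset.Icc 2 I.length) := by
    ext x; simp only [Finset.mem_insert, Finset.mem_Icc]; omega
  rw [e, Finset.sum_insert (by simp)]
  congr 2
  obtain ⟨r, hr⟩ : ∃ r, I.length = r + 1 := ⟨I.length - 1, by omega⟩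
  rw [hr, Nat.add_sub_cancel, pow_succ]; omega

theorem xIu_low {n : ℕ} (hn : 0 < n) (i : ℕ) (I : List ℕ) (hI : 1 ≤ I.length)
    (hI2 : ∀ x ∈ I, 1 ≤ x ∧ x ≤ n) (k : Fin n) :
    xIuExp n I 1 k + lowOf (fun b => lab n hn (I.reverse.getD b i)) I.length k = 2 ^ I.length - 1 := by
  rw [xIu_eq n I hI, lowOf, ← Finset.sum_add_distrib]
  have : ∑ b ∈ Finset.range I.length, 2 ^ b = 2 ^ I.length - 1 := by
    rw [Nat.geomSum_eq (le_refl 2)]; simp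
  rw [← this]
  refine Finset.sum_congr rfl fun b hb => ?_
  have hb := Finset.mem_range.1 hb
  have e1 : I.reverse.getD b i = I[I.length - 1 - b] := by
    rw [List.getD_eq_getElem _ _ (by simpa using hb), List.getElem_reverse]
  have e2 : I.getD (I.length - 1 - b) 0 = I[I.length - 1 - b] := by
    rw [List.getD_eq_getElem _ _ (by omega)]
  have hm := hI2 _ (List.getElem_mem (show I.length - 1 - b < I.length by omega))
  rw [e1, e2]
  simp only [lab_iff hn _ hm.1 hm.2]
  split_ifs <;> simp

theorem fIdx_inj (n i : ℕ) : Function.Injective (fIdx n i) := by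
  intro a b h
  unfold fIdx at h
  apply Fin.ext
  split_ifs at h <;> simp only [Fin.mk.injEq] at h <;> omega

theorem map_const (n i e : ℕ) (k : Fin n) (hi : 1 ≤ i) (hin : i ≤ n) :
    Finsupp.mapDomain (fIdx n i) (Xexp (n - 1) e) k = if (k : ℕ) + 1 = i then 0 else e := by
  have hk := k.isLt
  split_ifs with h
  · refine Finsupp.mapDomain_notin_range _ _ ?_
    rintro ⟨a, ha⟩
    unfold fIdx at ha
    split_ifs at ha <;> rw [Fin.ext_iff] at ha <;> simp only at ha <;> omega
  · obtain ⟨a, ha⟩ : ∃ a : Fin (n - 1), fIdx n i a = k := by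
      by_cases hlt : (k : ℕ) + 1 < i
      · refine ⟨⟨k, by omega⟩, ?_⟩
        simp [fIdx, hlt]
      · refine ⟨⟨(k : ℕ) - 1, by omega⟩, ?_⟩
        rw [fIdx, if_neg (by simp only; omega)]
        apply Fin.ext; simp only; omega
    rw [← ha, Finsupp.mapDomain_apply (fIdx_inj n i)]
    rfl

theorem nuE_const (m e k : ℕ) (hk : k - 1 < m) : nuE (Xexp m e) k = e := by
  rw [nuE, dif_pos hk]; rfl

theorem phi_match {n d : ℕ} (hn : 0 < n) (i : ℕ) (hi : 1 ≤ i) (hin : i ≤ n - 1)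
    (I : List ℕ) (hI : 1 ≤ I.length) (hId : I.length < d) (hI2 : ∀ x ∈ I, i + 1 ≤ x ∧ x ≤ n) :
    phiMon n i I (Xexp (n - 1) (2 ^ d - 1)) * xvMon n n (2 ^ d) = mono n d hn I.reverse i n := by
  have hpow : 2 ^ I.length < 2 ^ d := Nat.pow_lt_pow_right (by norm_num) hId
  have hpos : 0 < 2 ^ I.length := by positivity
  have hne : I ≠ [] := by rintro rfl; simp at hI
  have hnu : ∀ t, t < I.length → nuE (Xexp (n - 1) (2 ^ d - 1)) (I.getD t 0 - 1) = 2 ^ d - 1 := by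
    intro t ht
    refine nuE_const _ _ _ ?_
    rw [List.getD_eq_getElem _ _ ht]
    have := hI2 _ (List.getElem_mem ht)
    omega
  have hex : ∃ u, uCompat I u (Xexp (n - 1) (2 ^ d - 1)) := by
    refine ⟨1, ?_⟩
    rw [uCompat, if_neg hne]
    refine ⟨le_rfl, hI, fun t _ _ => by omega, ?_, ?_, ?_⟩
    · rw [hnu _ (by omega)]; omega
    · intro t h1 h2
      rw [hnu _ (by omega), Nat.testBit_two_pow_sub_one]
      simp; omega
    · intro t h1 h2
      rw [hnu _ (by omega), Nat.testBit_two_pow_sub_one]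
      simp; omega
  have hch : Classical.choose hex = 1 := by
    have h := Classical.choose_spec hex
    rw [uCompat, if_neg hne] at h
    by_contra hcon
    have := h.2.2.1 1 le_rfl (by omega)
    rw [hnu _ (by omega)] at this
    omega
  rw [phiMon, dif_pos hex, hch, xvMon, monomial_mul, one_mul, mono, MO, NN]
  refine congrArg (fun v => (monomial v 1 : P n)) ?_
  ext k
  rw [Finsupp.add_apply, ev_apply, ev_apply, ev_apply, map_const n i _ k hi (by omega)]
  have hx := xIu_low hn i I hI (fun x hx => ⟨by have := hI2 x hx; omega, (hI2 x hx).2⟩) k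
  obtain ⟨t, rfl⟩ : ∃ t, d = I.length + t := ⟨d - I.length, by omega⟩
  have hc : (fun b => lab n hn (I.reverse.getD (I.length + b) i)) = fun _ => lab n hn i := by
    funext b
    rw [List.getD_eq_default _ _ (by simp)]
  have hl := lab_iff hn i hi (by omega) k
  have hl' := lab_iff hn n (by omega) le_rfl k
  have hsingle : (Pi.single (M := fun _ => ℕ) (lab n hn n) 1 k) = if (k : ℕ) + 1 = n then 1 else 0 := by
    rw [Pi.single_apply]
    refine if_congr ?_ rfl rfl
    rw [eq_comm, hl', eq_comm]
  rw [lowOf_split, hc, lowOf_const, hsingle]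
  have e3 : (if (k : ℕ) + 1 = n then 2 ^ (I.length + t) else 0)
      = 2 ^ (I.length + t) * (if (k : ℕ) + 1 = n then 1 else 0) := by split_ifs <;> simp
  rw [e3]
  congr 1
  by_cases hk : (k : ℕ) + 1 = i
  · rw [if_pos hk, if_pos hk, if_pos (hl.2 hk.symm)]
    have : xIuExp n I 1 k = 0 := by
      rw [xIu_eq n I hI]
      refine Finset.sum_eq_zero fun b hb => ?_
      have hb := Finset.mem_range.1 hb
      rw [List.getD_eq_getElem _ _ (by omega), if_neg]
      have := hI2 _ (List.getElem_mem (show I.length - 1 - b < I.length by omega))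
      omega
    omega
  · rw [if_neg hk, if_neg hk, if_neg (fun h => hk (hl.1 h).symm)]
    have hp : 2 ^ (I.length + t) = 2 ^ I.length * (2 ^ t - 1) + 2 ^ I.length := by
      rw [pow_add]
      have : 0 < 2 ^ t := by positivity
      obtain ⟨B, hB⟩ : ∃ B, 2 ^ t = B + 1 := ⟨2 ^ t - 1, by omega⟩
      rw [hB, Nat.add_sub_cancel]; ring
    rw [hp]
    omega

theorem lead_match {n d : ℕ} (hn : 0 < n) :
    XjMon n n (2 ^ d - 1) * xvMon n n (2 ^ d) = mono n d hn [] n n := by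
  rw [XjMon, xvMon, monomial_mul, one_mul, mono, MO, NN]
  refine congrArg (fun v => (monomial v 1 : P n)) ?_
  ext k
  rw [Finsupp.add_apply, ev_apply, ev_apply, ev_apply]
  have hl' := lab_iff hn n (by omega) le_rfl k
  simp only [List.getD_nil, lowOf_const, hl', Pi.single_apply, eq_comm (a := k)]
  by_cases h : n = (k : ℕ) + 1
  · simp [h.symm]
  · simp [h, Ne.symm h]

/-- Proposition 3.11: for `d ≥ n ≥ 2`,
`X_n^{2^d−1} x_n^{2^d} + Σ_{(i;I)∈N_{n−1}} φ_{(i;I∪n)}(X^{2^d−1}) x_n^{2^d}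
∈ A_n^+P_n + P_n^−(ω)` with `ω = ((n−1)^{(d)}, 1)`.  A pair `(i;I) ∈ N_{n−1}` is
encoded as `1 ≤ i ≤ n−1` together with a finite set `S ⊆ {i+1, …, n−1}`. -/
theorem statement12 (n d : ℕ) (hn : 2 ≤ n) (hd : n ≤ d) :
    XjMon n n (2 ^ d - 1) * xvMon n n (2 ^ d)
    + (∑ i ∈ Finset.Icc 1 (n - 1), ∑ S ∈ (Finset.Icc (i + 1) (n - 1)).powerset,
        phiMon n i ((insert n S).sort (· ≤ ·)) (Xexp (n - 1) (2 ^ d - 1))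
          * xvMon n n (2 ^ d))
    ∈ AplusS n n ⊔ PnLt n ((n - 1) * (2 ^ d - 1) + 2 ^ d) (wSpike n d) := by
  have hn0 : 0 < n := by omega
  change _ ∈ WW n d
  have hsum : XjMon n n (2 ^ d - 1) * xvMon n n (2 ^ d)
      + (∑ i ∈ Finset.Icc 1 (n - 1), ∑ S ∈ (Finset.Icc (i + 1) (n - 1)).powerset,
        phiMon n i ((insert n S).sort (· ≤ ·)) (Xexp (n - 1) (2 ^ d - 1)) * xvMon n n (2 ^ d))
      = mono n d hn0 [] n n + ∑ i ∈ Finset.Icc 1 (n - 1),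
        ∑ S ∈ (Finset.Icc (i + 1) (n - 1)).powerset,
          mono n d hn0 ((insert n S).sort (· ≤ ·)).reverse i n := by
    rw [lead_match hn0]
    refine congrArg _ (Finset.sum_congr rfl fun i hi => Finset.sum_congr rfl fun S hS => ?_)
    have hi := Finset.mem_Icc.1 hi
    have hS := Finset.mem_powerset.1 hS
    have hc := Finset.card_le_card hS
    have hc2 := Finset.card_insert_le n S
    have hc3 := Finset.card_pos.2 (Finset.insert_nonempty n S)
    simp only [Nat.card_Icc] at hc
    refine phi_match hn0 i hi.1 hi.2 _ ?_ ?_ ?_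
    · rw [Finset.length_sort]; omega
    · rw [Finset.length_sort]; omega
    · intro x hx
      rw [Finset.mem_sort, Finset.mem_insert] at hx
      rcases hx with rfl | hx
      · omega
      · have := Finset.mem_Icc.1 (hS hx); omega
  rw [hsum, ← pr_zero, map_add, map_sum]
  have h := sum_c hn0 hd
  rw [sum_min] at h
  rw [← h, Finset.toList_empty]
  refine congrArg _ (Finset.sum_congr rfl fun i hi => ?_)
  rw [map_sum]
  refine Finset.sum_congr rfl fun S hS => ?_
  have hi := Finset.mem_Icc.1 hi
  exact (step5 hn0 hd i hi.1 hi.2 S (Finset.mem_powerset.1 hS)).symm
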